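/- Let 0 < a ≤ b be real constants. There is a constant C = C(a, b) > 0 such that for every integer n ≥ 4, every integer d with 2 ≤ d ≤ n/2, and all p, q ∈ (0,1) with a/(n·ln n) ≤ p ≤ b/(n·ln n) and a/(n·ln n) ≤ q ≤ b/(n·ln n), the MMAHH with acceptance operators OI and OW on Cliff_d, started from x_0 uniformly distributed on {0,1}^n and s_0 = OI, has runtime T satisfying E[T] ≤ C·(n³/d²)·ln n. -/

import Mathlib

open MeasureTheory
open scoped ENNReal NNReal

namespace MMAHHStmt

/-- The two acceptance operators. -/
inductive Op : Type
  | OI : Op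
  | OW : Op
  deriving DecidableEq

instance : MeasurableSpace Op := ⊤

/-- Search points: bit-strings of length `n`. -/
abbrev Point (n : ℕ) := Fin n → Bool

/-- The number of one-bits of a bit-string. -/
def ones {n : ℕ} (x : Point n) : ℕ := (Finset.univ.filter fun i => x i = true).card

/-- The all-ones string, the global optimum of all benchmarks considered. -/
def optimum (n : ℕ) : Point n := fun _ => true

/-- Flipping the bit in position `v`. -/
def flipBit {n : ℕ} (x : Point n) (v : Fin n) : Point n := Function.update x v (!(x v))

open Classical in
/-- The search point obtained from `x` by proposing to flip bit `v` and applying the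
acceptance operator `op` for the objective function `f`. -/
noncomputable def movedPoint {n : ℕ} (f : Point n → ℝ) (op : Op) (x : Point n) (v : Fin n) :
    Point n :=
  match op with
  | Op.OI => if f x < f (flipBit x v) then flipBit x v else x
  | Op.OW => if f (flipBit x v) < f x then flipBit x v else x

open Classical in
/-- One-step transition probability of the search point under acceptance operator `op`:
a uniformly random bit is flipped and the move is accepted or rejected according to `op`. -/
noncomputable def moveProb {n : ℕ} (f : Point n → ℝ) (op : Op) (x x' : Point n) : ℝ≥0∞ :=
  ((Finset.univ.filter fun v => movedPoint f op x v = x').card : ℝ≥0∞) / n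

/-- Transition probabilities of the two-state Markov chain on the acceptance operators. -/
noncomputable def switchProb (p q : ℝ) : Op → Op → ℝ≥0∞
  | Op.OI, Op.OI => ENNReal.ofReal (1 - p)
  | Op.OI, Op.OW => ENNReal.ofReal p
  | Op.OW, Op.OI => ENNReal.ofReal q
  | Op.OW, Op.OW => ENNReal.ofReal (1 - q)

/-- One-step transition probabilities of the MMAHH on the state space
`Point n × Op`: the search point moves according to the current acceptance operator, and,
independently, the operator switches according to the two-state Markov chain. -/
noncomputable def mmahhTrans {n : ℕ} (f : Point n → ℝ) (p q : ℝ) :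
    Point n × Op → Point n × Op → ℝ≥0∞ :=
  fun s s' => moveProb f s.2 s.1 s'.1 * switchProb p q s.2 s'.2

/-- `X` is (a version of) the MMAHH Markov chain with objective function `f` and switching
probabilities `p` and `q`, under the measure `μ`: each `X t` is measurable, and conditionally
on any history, the next state is distributed according to `mmahhTrans`. -/
def IsMMAHH {n : ℕ} {Ω : Type*} [MeasurableSpace Ω] (μ : Measure Ω)
    (X : ℕ → Ω → Point n × Op) (f : Point n → ℝ) (p q : ℝ) : Prop :=
  (∀ t, Measurable (X t)) ∧
  ∀ (t : ℕ) (σ : ℕ → Point n × Op) (s' : Point n × Op),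
    μ {ω | (∀ i ≤ t, X i ω = σ i) ∧ X (t + 1) ω = s'}
      = μ {ω | ∀ i ≤ t, X i ω = σ i} * mmahhTrans f p q (σ t) s'

/-- The runtime: the first hitting time of the global optimum, as an extended natural number
(`⊤` if the optimum is never reached). -/
noncomputable def hitTime {n : ℕ} {Ω : Type*} (X : ℕ → Ω → Point n × Op) (ω : Ω) : ℕ∞ :=
  ⨅ t ∈ {t : ℕ | (X t ω).1 = optimum n}, (t : ℕ∞)

/-- The `k`-th switching time between the two acceptance operators (with junk value given by
`Nat.sInf ∅ = 0` on the probability-zero event that no further switch occurs). -/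
noncomputable def switchTime {n : ℕ} {Ω : Type*} (X : ℕ → Ω → Point n × Op) : ℕ → Ω → ℕ
  | 0, _ => 0
  | k + 1, ω =>
      sInf {t : ℕ | switchTime X k ω ≤ t ∧ (X t ω).2 ≠ (X (switchTime X k ω) ω).2}

/-- The Cliff benchmark with difficulty parameter `d`. -/
noncomputable def Cliff (n d : ℕ) (x : Point n) : ℝ :=
  if ones x ≤ n - d then (ones x : ℝ) else (ones x : ℝ) - (d : ℝ) + 1 / 2

section Drift
open Finset

lemma drift_abstract {S Ω : Type*} [Fintype S] [MeasurableSpace S] [MeasurableSingletonClass S]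
    [MeasurableSpace Ω] (μ : Measure Ω) [IsProbabilityMeasure μ] (X : ℕ → Ω → S)
    (P : S → S → ℝ≥0∞) (hmeas : ∀ t, Measurable (X t))
    (hM : ∀ (t : ℕ) (σ : ℕ → S) (s' : S),
      μ {ω | (∀ i ≤ t, X i ω = σ i) ∧ X (t + 1) ω = s'}
        = μ {ω | ∀ i ≤ t, X i ω = σ i} * P (σ t) s')
    (G : S → Prop) (V : S → ℝ≥0∞) (B : ℝ≥0∞) (hB : ∀ s, V s ≤ B)
    (hV : ∀ s, ¬ G s → 1 + ∑ s', P s s' * V s' ≤ V s) :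
    ∑' t : ℕ, μ {ω | ∀ i ≤ t, ¬ G (X i ω)} ≤ B := by
  classical
  -- decomposing over histories
  have hist : ∀ (t : ℕ) (Q : (Fin (t + 1) → S) → Prop) (R : Set Ω), MeasurableSet R →
      μ {ω | Q (fun i => X i ω) ∧ ω ∈ R}
        = ∑ h ∈ univ.filter Q, μ {ω | (∀ i : Fin (t + 1), X i ω = h i) ∧ ω ∈ R} := by
    intro t Q R hR
    have hm : Measurable (fun ω => fun i : Fin (t + 1) => X i ω) :=
      measurable_pi_lambda _ fun i => hmeas i
    have h1 := sum_measure_preimage_singleton (μ := μ.restrict R) (univ.filter Q)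
      (f := fun ω => fun i : Fin (t + 1) => X i ω)
      (fun y _ => hm (measurableSet_singleton y))
    rw [Measure.restrict_apply' hR] at h1
    have e1 : {ω | Q (fun i => X i ω) ∧ ω ∈ R}
        = (fun ω => fun i : Fin (t + 1) => X i ω) ⁻¹' ↑(univ.filter Q) ∩ R := by
      ext ω; simp
    rw [e1, ← h1]
    refine Finset.sum_congr rfl fun h _ => ?_
    rw [Measure.restrict_apply' hR]
    congr 1
    ext ω
    simp [funext_iff]
  have markov : ∀ (t : ℕ) (Q : (Fin (t + 1) → S) → Prop) (s s' : S),
      (∀ h, Q h → h (Fin.last t) = s) →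
      μ {ω | Q (fun i => X i ω) ∧ X (t + 1) ω = s'}
        = μ {ω | Q (fun i => X i ω)} * P s s' := by
    intro t Q s s' hQ
    have h1 := hist t Q {ω | X (t + 1) ω = s'} (hmeas (t + 1) (measurableSet_singleton s'))
    have h2 := hist t Q Set.univ MeasurableSet.univ
    simp only [Set.mem_ofPred_eq, Set.mem_univ, and_true] at h1 h2
    rw [h1, h2, Finset.sum_mul]
    refine Finset.sum_congr rfl fun h hh => ?_
    have h3 := hM t (fun i => if hi : i < t + 1 then h ⟨i, hi⟩ else s) s'
    have e : ∀ ω, (∀ i ≤ t, X i ω = (fun i => if hi : i < t + 1 then h ⟨i, hi⟩ else s) i)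
        ↔ (∀ i : Fin (t + 1), X i ω = h i) := by
      intro ω
      constructor
      · intro H i
        have := H i (by omega)
        simp only [i.isLt, dif_pos] at this
        exact this
      · intro H i hi
        have := H ⟨i, by omega⟩
        simp only [show i < t + 1 by omega, dif_pos]
        exact this
    simp only [e] at h3
    rw [h3]
    congr 2
    have := hQ h (by simpa using hh)
    simp only [show t < t + 1 by omega, dif_pos]
    exact this
  -- weights
  set w : ℕ → S → ℝ≥0∞ := fun t s => μ {ω | (∀ i < t, ¬ G (X i ω)) ∧ X t ω = s} with hw
  have total : ∀ (t : ℕ) (R : Set Ω), MeasurableSet R →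
      μ R = ∑ s, μ {ω | ω ∈ R ∧ X t ω = s} := by
    intro t R hR
    have h1 := sum_measure_preimage_singleton (μ := μ.restrict R) (univ : Finset S)
      (f := X t) (fun y _ => hmeas t (measurableSet_singleton y))
    rw [Finset.coe_univ, Set.preimage_univ, Measure.restrict_apply_univ] at h1
    rw [← h1]
    refine Finset.sum_congr rfl fun s _ => ?_
    rw [Measure.restrict_apply' hR]
    congr 1
    ext ω
    simp [and_comm]
  have msG : ∀ i, MeasurableSet {ω | ¬ G (X i ω)} := fun i =>
    hmeas i (Set.toFinite {s | ¬ G s}).measurableSet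
  have msA : ∀ t, MeasurableSet {ω | ∀ i ≤ t, ¬ G (X i ω)} := by
    intro t
    have : {ω | ∀ i ≤ t, ¬ G (X i ω)} = ⋂ i, ⋂ (_ : i ≤ t), {ω | ¬ G (X i ω)} := by
      ext; simp
    rw [this]
    exact MeasurableSet.iInter fun i => MeasurableSet.iInter fun _ => msG i
  have split : ∀ t s, μ {ω | (∀ i ≤ t, ¬ G (X i ω)) ∧ X t ω = s}
      = if G s then 0 else w t s := by
    intro t s
    split_ifs with hs
    · have : {ω | (∀ i ≤ t, ¬ G (X i ω)) ∧ X t ω = s} = ∅ := by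
        ext ω
        simp only [Set.mem_ofPred_eq, Set.mem_empty_iff_false, iff_false]
        rintro ⟨h1, h2⟩
        exact h1 t le_rfl (h2 ▸ hs)
      rw [this, measure_empty]
    · rw [hw]
      congr 1
      ext ω
      simp only [Set.mem_ofPred_eq]
      constructor
      · rintro ⟨h1, h2⟩
        exact ⟨fun i hi => h1 i hi.le, h2⟩
      · rintro ⟨h1, h2⟩
        refine ⟨fun i hi => ?_, h2⟩
        rcases hi.lt_or_eq with h | h
        · exact h1 i h
        · subst h; rwa [h2]
  have hA : ∀ t, μ {ω | ∀ i ≤ t, ¬ G (X i ω)} = ∑ s, if G s then 0 else w t s := by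
    intro t
    rw [total t _ (msA t)]
    exact Finset.sum_congr rfl fun s _ => split t s
  have hstep : ∀ t s', w (t + 1) s' = ∑ s, (if G s then 0 else w t s) * P s s' := by
    intro t s'
    have e1 : w (t + 1) s' = μ {ω | ω ∈ {ω | ∀ i ≤ t, ¬ G (X i ω)} ∧ X (t + 1) ω = s'} := by
      rw [hw]; simp
    have ms : MeasurableSet {ω | ω ∈ {ω | ∀ i ≤ t, ¬ G (X i ω)} ∧ X (t + 1) ω = s'} :=
      (msA t).inter (hmeas (t + 1) (measurableSet_singleton s'))
    rw [e1, total t _ ms]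
    refine Finset.sum_congr rfl fun s _ => ?_
    have h := markov t (fun h => (∀ i, ¬ G (h i)) ∧ h (Fin.last t) = s) s s' (fun h hh => hh.2)
    have e2 : ∀ ω, ((∀ i : Fin (t + 1), ¬ G (X i ω)) ∧ X (Fin.last t : Fin (t+1)) ω = s) ↔
        ((∀ i ≤ t, ¬ G (X i ω)) ∧ X t ω = s) := by
      intro ω
      simp only [Fin.val_last]
      refine and_congr_left fun _ => ?_
      constructor
      · intro H i hi; exact H ⟨i, by omega⟩
      · intro H i; exact H i (by omega)
    simp only [e2] at h
    rw [split t s] at h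
    rw [← h]
    congr 1
    ext ω
    simp only [Set.mem_ofPred_eq]
    tauto
  have tele : ∀ N, ∑ t ∈ range N, μ {ω | ∀ i ≤ t, ¬ G (X i ω)} + ∑ s, w N s * V s
      ≤ ∑ s, w 0 s * V s := by
    intro N
    induction N with
    | zero => simp
    | succ N ih =>
      refine le_trans ?_ ih
      rw [Finset.sum_range_succ, add_assoc]
      gcongr
      rw [hA N]
      have : ∑ s', w (N + 1) s' * V s'
          = ∑ s, (if G s then 0 else w N s) * ∑ s', P s s' * V s' := by
        simp only [hstep, Finset.sum_mul, Finset.mul_sum]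
        rw [Finset.sum_comm]
        simp only [mul_assoc]
      rw [this, ← Finset.sum_add_distrib]
      refine Finset.sum_le_sum fun s _ => ?_
      split_ifs with hs
      · simp
      · calc w N s + w N s * ∑ s', P s s' * V s' = w N s * (1 + ∑ s', P s s' * V s') := by ring
          _ ≤ _ := by gcongr; exact hV s hs
  have h0 : ∑ s, w 0 s * V s ≤ B := by
    calc ∑ s, w 0 s * V s ≤ ∑ s, w 0 s * B := by gcongr with s; exact hB s
      _ = (∑ s, w 0 s) * B := by rw [Finset.sum_mul]
      _ = 1 * B := by
        congr 1
        have := total 0 Set.univ MeasurableSet.univ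
        simp only [Set.mem_univ, true_and, measure_univ] at this
        rw [this, hw]; simp
      _ = B := one_mul B
  rw [ENNReal.tsum_eq_iSup_nat]
  exact iSup_le fun N => (le_self_add.trans (tele N)).trans h0

lemma hitTime_le {n : ℕ} {Ω : Type*} (X : ℕ → Ω → Point n × Op) (ω : Ω) :
    (hitTime X ω : ℝ≥0∞) ≤
      ∑' t : ℕ, ({ω | ∀ i ≤ t, ¬ (X i ω).1 = optimum n} : Set Ω).indicator 1 ω := by
  classical
  by_cases h : ∃ t, (X t ω).1 = optimum n
  · have h1 : hitTime X ω ≤ (Nat.find h : ℕ∞) := by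
      unfold hitTime
      exact iInf₂_le (Nat.find h) (Nat.find_spec h)
    have h2 : (hitTime X ω : ℝ≥0∞) ≤ (Nat.find h : ℝ≥0∞) := by
      have := ENat.toENNReal_mono h1
      simpa using this
    refine h2.trans ?_
    refine le_trans ?_ (ENNReal.sum_le_tsum (Finset.range (Nat.find h)))
    rw [Finset.sum_congr rfl (g := fun _ => (1 : ℝ≥0∞))]
    · simp
    · intro t ht
      rw [Set.indicator_of_mem]
      · rfl
      · intro i hi
        exact Nat.find_min h (lt_of_le_of_lt hi (Finset.mem_range.1 ht))
  · push Not at h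
    have : ∑' t : ℕ, ({ω | ∀ i ≤ t, ¬ (X i ω).1 = optimum n} : Set Ω).indicator
        (1 : Ω → ℝ≥0∞) ω = ∑' t : ℕ, (1 : ℝ≥0∞) := by
      congr 1; ext t
      rw [Set.indicator_of_mem]
      · rfl
      · intro i _; exact h i
    rw [this, ENNReal.tsum_const_eq_top_of_ne_zero one_ne_zero]
    exact le_top

instance : Fintype Op := ⟨{Op.OI, Op.OW}, fun x => by cases x <;> simp⟩
instance : MeasurableSingletonClass Op := ⟨fun _ => trivial⟩

end Drift

section Layer
open Finset

/-- Number of zero bits. -/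
def zeros {n : ℕ} (x : Point n) : ℕ := (Finset.univ.filter fun i => x i = false).card

lemma ones_add_zeros {n : ℕ} (x : Point n) : ones x + zeros x = n := by
  have := Finset.card_filter_add_card_filter_not (s := (Finset.univ : Finset (Fin n)))
    (fun i => x i = true)
  simpa [ones, zeros] using this

/-- Layer reached when a zero-bit is proposed to be flipped. -/
def dn (d : ℕ) : Op → ℕ → ℕ
  | Op.OI, k => if k = d then k else k - 1
  | Op.OW, k => if k = d then k - 1 else k

/-- Layer reached when a one-bit is proposed to be flipped. -/
def up (d : ℕ) : Op → ℕ → ℕ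
  | Op.OI, k => if k + 1 = d then k + 1 else k
  | Op.OW, k => if k + 1 = d then k else k + 1

/-- Averaging over the operator switch. -/
noncomputable def sw (p q : ℝ) (v : ℕ → Op → ℝ) : Op → ℕ → ℝ
  | Op.OI, k => (1 - p) * v k Op.OI + p * v k Op.OW
  | Op.OW, k => (1 - q) * v k Op.OW + q * v k Op.OI

lemma zeros_flip_false {n : ℕ} (x : Point n) (i : Fin n) (h : x i = false) :
    zeros (flipBit x i) + 1 = zeros x := by
  have h1 : (univ.filter fun j => flipBit x i j = false)
      = (univ.filter fun j => x j = false).erase i := by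
    ext j
    by_cases hj : j = i
    · subst hj; simp [flipBit, h]
    · have e : flipBit x i j = x j := Function.update_of_ne hj _ _
      simp [e, hj]
  unfold zeros
  rw [h1]
  exact Finset.card_erase_add_one (by simp [h])

lemma zeros_flip_true {n : ℕ} (x : Point n) (i : Fin n) (h : x i = true) :
    zeros (flipBit x i) = zeros x + 1 := by
  have h1 : (univ.filter fun j => flipBit x i j = false)
      = insert i (univ.filter fun j => x j = false) := by
    ext j
    by_cases hj : j = i
    · subst hj; simp [flipBit, h]
    · have e : flipBit x i j = x j := Function.update_of_ne hj _ _
      simp [e, hj]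
  unfold zeros
  rw [h1]
  exact Finset.card_insert_of_notMem (by simp [h])

lemma cliff_eq {n d : ℕ} (hd : d ≤ n) (x : Point n) :
    Cliff n d x = if d ≤ zeros x then (n : ℝ) - zeros x else (n : ℝ) - zeros x - d + 1 / 2 := by
  have h := ones_add_zeros x
  have h' : (ones x : ℝ) = n - zeros x := by
    rw [eq_sub_iff_add_eq]; exact_mod_cast h
  have : ones x ≤ n - d ↔ d ≤ zeros x := by omega
  unfold Cliff
  simp only [this, h']

lemma moved_zeros {n d : ℕ} (hd2 : 2 ≤ d) (hd : d ≤ n) (op : Op) (x : Point n) (i : Fin n) :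
    zeros (movedPoint (Cliff n d) op x i)
      = if x i = true then up d op (zeros x) else dn d op (zeros x) := by
  have hd2' : (2 : ℝ) ≤ d := by exact_mod_cast hd2
  cases hx : x i with
  | true =>
    have hz := zeros_flip_true x i hx
    have hz' : (zeros (flipBit x i) : ℝ) = zeros x + 1 := by exact_mod_cast hz
    simp only [if_true]
    have key : (Cliff n d x < Cliff n d (flipBit x i) ↔ zeros x + 1 = d) ∧
      (Cliff n d (flipBit x i) < Cliff n d x ↔ ¬ (zeros x + 1 = d)) := by
      rw [cliff_eq hd, cliff_eq hd, hz', hz]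
      rcases lt_trichotomy (zeros x + 1) d with h | h | h
      · rw [if_neg (by omega), if_neg (by omega)]
        constructor <;> constructor <;> intro h3 <;> first | omega | linarith
      · have h4 : (zeros x : ℝ) + 1 = d := by exact_mod_cast h
        rw [if_neg (by omega), if_pos (by omega)]
        constructor <;> constructor <;> intro h3 <;> first | omega | linarith
      · rw [if_pos (by omega), if_pos (by omega)]
        constructor <;> constructor <;> intro h3 <;> first | omega | linarith
    cases op with
    | OI =>
      simp only [movedPoint, up, key.1]
      split_ifs <;> simp [hz]
    | OW =>
      simp only [movedPoint, up, key.2]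
      split_ifs <;> simp [hz]
  | false =>
    have hz := zeros_flip_false x i hx
    have hz' : (zeros x : ℝ) = zeros (flipBit x i) + 1 := by exact_mod_cast hz.symm
    simp only [Bool.false_eq_true, if_false]
    have key : (Cliff n d x < Cliff n d (flipBit x i) ↔ ¬ zeros x = d) ∧
      (Cliff n d (flipBit x i) < Cliff n d x ↔ (zeros x = d)) := by
      rw [cliff_eq hd, cliff_eq hd, hz', ← hz]
      rcases lt_trichotomy (zeros (flipBit x i) + 1) d with h | h | h
      · rw [if_neg (by omega), if_neg (by omega)]
        constructor <;> constructor <;> intro h3 <;> first | omega | linarith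
      · have h4 : (zeros (flipBit x i) : ℝ) + 1 = d := by exact_mod_cast h
        rw [if_pos (by omega), if_neg (by omega)]
        constructor <;> constructor <;> intro h3 <;> first | omega | linarith
      · rw [if_pos (by omega), if_pos (by omega)]
        constructor <;> constructor <;> intro h3 <;> first | omega | linarith
    cases op with
    | OI =>
      simp only [movedPoint, dn, key.1]
      split_ifs <;> first | rfl | omega
    | OW =>
      simp only [movedPoint, dn, key.2]
      split_ifs <;> first | rfl | omega

lemma zeros_pos {n : ℕ} (x : Point n) (h : x ≠ optimum n) : 1 ≤ zeros x := by
  by_contra h0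
  apply h
  have : zeros x = 0 := by omega
  unfold zeros at this
  rw [Finset.card_eq_zero, Finset.filter_eq_empty_iff] at this
  funext i
  have := this (mem_univ i)
  simpa [optimum] using this

lemma move_sum {n : ℕ} (f : Point n → ℝ) (op : Op) (x : Point n) (E : Point n → ℝ≥0∞) :
    ∑ x', moveProb f op x x' * E x' = (∑ i, E (movedPoint f op x i)) / n := by
  classical
  rw [← Finset.sum_fiberwise (s := univ) (g := fun i => movedPoint f op x i),
    ENNReal.div_eq_inv_mul, Finset.mul_sum]
  refine Finset.sum_congr rfl fun x' _ => ?_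
  rw [Finset.sum_congr rfl (g := fun _ => E x')]
  · rw [Finset.sum_const, nsmul_eq_mul]
    unfold moveProb
    rw [ENNReal.div_eq_inv_mul, mul_assoc]
  · intro i hi
    rw [(Finset.mem_filter.1 hi).2]

lemma layer_drift {n d : ℕ} (hd2 : 2 ≤ d) (hd : d ≤ n) {p q : ℝ} (hp0 : 0 < p) (hp1 : p < 1)
    (hq0 : 0 < q) (hq1 : q < 1) (v : ℕ → Op → ℝ) (hv : ∀ k op, 0 ≤ v k op)
    (hdr : ∀ k op, 1 ≤ k → k ≤ n →
      1 + (k / n * sw p q v op (dn d op k) + (n - k) / n * sw p q v op (up d op k)) ≤ v k op)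
    (s : Point n × Op) (hs : s.1 ≠ optimum n) :
    1 + ∑ s', mmahhTrans (Cliff n d) p q s s' * ENNReal.ofReal (v (zeros s'.1) s'.2)
      ≤ ENNReal.ofReal (v (zeros s.1) s.2) := by
  obtain ⟨x, op⟩ := s
  simp only at hs ⊢
  have hn : 0 < n := by omega
  have hnr : (0 : ℝ) < n := by exact_mod_cast hn
  have sw_nonneg : ∀ op k, 0 ≤ sw p q v op k := by
    intro op k
    have := hv k Op.OI
    have := hv k Op.OW
    have : 0 ≤ 1 - p := by linarith
    have : 0 ≤ 1 - q := by linarith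
    cases op <;> simp only [sw] <;> positivity
  have h1 : ∑ s', mmahhTrans (Cliff n d) p q (x, op) s' * ENNReal.ofReal (v (zeros s'.1) s'.2)
      = ∑ x', moveProb (Cliff n d) op x x' * ENNReal.ofReal (sw p q v op (zeros x')) := by
    rw [Fintype.sum_prod_type]
    refine Finset.sum_congr rfl fun x' _ => ?_
    have hu : (univ : Finset Op) = {Op.OI, Op.OW} := rfl
    rw [hu, Finset.sum_pair (by simp)]
    simp only [mmahhTrans, mul_assoc]
    rw [← mul_add]
    congr 1
    have h1p : 0 ≤ 1 - p := by linarith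
    have h1q : 0 ≤ 1 - q := by linarith
    have a1 := hv (zeros x') Op.OI
    have a2 := hv (zeros x') Op.OW
    cases op
    · simp only [switchProb, sw]
      rw [ENNReal.ofReal_add (by positivity) (by positivity), ENNReal.ofReal_mul h1p,
        ENNReal.ofReal_mul hp0.le]
    · simp only [switchProb, sw]
      rw [ENNReal.ofReal_add (by positivity) (by positivity), ENNReal.ofReal_mul h1q,
        ENNReal.ofReal_mul hq0.le, add_comm]
  rw [h1, move_sum, ← ENNReal.ofReal_sum_of_nonneg (fun _ _ => sw_nonneg _ _)]
  have h2 : ∑ i, sw p q v op (zeros (movedPoint (Cliff n d) op x i))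
      = zeros x * sw p q v op (dn d op (zeros x))
        + (n - zeros x) * sw p q v op (up d op (zeros x)) := by
    have h3 : ∀ i, sw p q v op (zeros (movedPoint (Cliff n d) op x i))
      = if x i = false then sw p q v op (dn d op (zeros x))
        else sw p q v op (up d op (zeros x)) := by
      intro i
      rw [moved_zeros hd2 hd]
      cases x i <;> simp
    simp only [h3]
    rw [Finset.sum_ite, Finset.sum_const, Finset.sum_const, nsmul_eq_mul, nsmul_eq_mul]
    have h4 : ((univ.filter fun i => ¬ x i = false).card : ℝ) = n - zeros x := by
      have := ones_add_zeros x
      rw [eq_sub_iff_add_eq]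
      have e : (univ.filter fun i => ¬ x i = false) = (univ.filter fun i => x i = true) := by
        simp
      rw [e]
      exact_mod_cast this
    rw [h4]
    rfl
  rw [h2]
  have h5 : (n : ℝ≥0∞) = ENNReal.ofReal n := by simp
  rw [h5, ← ENNReal.ofReal_div_of_pos hnr, ← ENNReal.ofReal_one]
  have hk : (zeros x : ℝ) ≤ n := by exact_mod_cast (by have := ones_add_zeros x; omega)
  have hk' : 0 ≤ (n : ℝ) - zeros x := by linarith
  have n1 := sw_nonneg op (dn d op (zeros x))
  have n2 := sw_nonneg op (up d op (zeros x))
  rw [← ENNReal.ofReal_add zero_le_one (by positivity)]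
  apply ENNReal.ofReal_le_ofReal
  refine le_trans (le_of_eq ?_) (hdr (zeros x) op (zeros_pos x hs)
    (by have := ones_add_zeros x; omega))
  field_simp

lemma runtime_le {n d : ℕ} (hd2 : 2 ≤ d) (hd : d ≤ n) {p q : ℝ} (hp0 : 0 < p) (hp1 : p < 1)
    (hq0 : 0 < q) (hq1 : q < 1) (v : ℕ → Op → ℝ) (hv : ∀ k op, 0 ≤ v k op)
    (hdr : ∀ k op, 1 ≤ k → k ≤ n →
      1 + (k / n * sw p q v op (dn d op k) + (n - k) / n * sw p q v op (up d op k)) ≤ v k op)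
    (B : ℝ) (hB : ∀ k op, k ≤ n → v k op ≤ B)
    {Ω : Type} [MeasurableSpace Ω] (μ : Measure Ω) (X : ℕ → Ω → Point n × Op)
    [IsProbabilityMeasure μ] (hX : IsMMAHH μ X (Cliff n d) p q) :
    ∫⁻ ω, (hitTime X ω : ℝ≥0∞) ∂μ ≤ ENNReal.ofReal B := by
  have h := drift_abstract μ X (mmahhTrans (Cliff n d) p q) hX.1 hX.2
    (fun s => s.1 = optimum n) (fun s => ENNReal.ofReal (v (zeros s.1) s.2)) (ENNReal.ofReal B)
    (fun s => ENNReal.ofReal_le_ofReal (hB _ _ (by have := ones_add_zeros s.1; omega)))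
    (fun s hs => layer_drift hd2 hd hp0 hp1 hq0 hq1 v hv hdr s hs)
  have ms : ∀ t, MeasurableSet {ω | ∀ i ≤ t, ¬ (X i ω).1 = optimum n} := by
    intro t
    have : {ω | ∀ i ≤ t, ¬ (X i ω).1 = optimum n}
        = ⋂ i, ⋂ (_ : i ≤ t), {ω | ¬ (X i ω).1 = optimum n} := by
      ext; simp
    rw [this]
    exact MeasurableSet.iInter fun i => MeasurableSet.iInter fun _ =>
      hX.1 i (Set.toFinite {s : Point n × Op | ¬ s.1 = optimum n}).measurableSet
  calc ∫⁻ ω, (hitTime X ω : ℝ≥0∞) ∂μ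
      ≤ ∫⁻ ω, ∑' t : ℕ, ({ω | ∀ i ≤ t, ¬ (X i ω).1 = optimum n} : Set Ω).indicator 1 ω ∂μ :=
        lintegral_mono fun ω => hitTime_le X ω
    _ = ∑' t : ℕ, ∫⁻ ω, ({ω | ∀ i ≤ t, ¬ (X i ω).1 = optimum n} : Set Ω).indicator 1 ω ∂μ :=
        lintegral_tsum fun t => (measurable_one.indicator (ms t)).aemeasurable
    _ = ∑' t : ℕ, μ {ω | ∀ i ≤ t, ¬ (X i ω).1 = optimum n} := by
        congr 1; ext t
        exact lintegral_indicator_one (ms t)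
    _ ≤ _ := h

end Layer

section Potentials

lemma arith_fall {p x A Y w w' h h' : ℝ} (hp0 : 0 < p) (hx0 : 0 ≤ x)
    (hY : 0 ≤ Y) (hw' : w' ≤ w) (hAY : A + Y = w + 1 / p)
    (hrec : h * (p + (1 - p) * x) ≤ (1 - p) * x * h') :
    1 + (x * ((1 - p) * (A + Y * (1 - h')) + p * w')
      + (1 - x) * ((1 - p) * (A + Y * (1 - h)) + p * w)) ≤ A + Y * (1 - h) := by
  have h1 : p * (A + Y) = p * w + 1 := by rw [hAY]; field_simp
  have h2 : x * (p * w') ≤ x * (p * w) := by gcongr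
  have h3 := mul_le_mul_of_nonneg_left hrec hY
  nlinarith

lemma arith_const {q x w L1 L2 : ℝ} (hq0 : 0 < q) (hx0 : 0 ≤ x) (hx1 : x ≤ 1)
    (h1 : L1 ≤ w - 1 / q) (h2 : L2 ≤ w - 1 / q) :
    1 + (x * ((1 - q) * w + q * L1) + (1 - x) * ((1 - q) * w + q * L2)) ≤ w := by
  have e : q * (w - 1 / q) = q * w - 1 := by field_simp
  have a1 : q * L1 ≤ q * w - 1 := by rw [← e]; gcongr
  have a2 : q * L2 ≤ q * w - 1 := by rw [← e]; gcongr
  have : 0 ≤ 1 - x := by linarith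
  have b1 := mul_le_mul_of_nonneg_left a1 hx0
  have b2 := mul_le_mul_of_nonneg_left a2 this
  nlinarith

/-- The main potential function. -/
noncomputable def pot (d : ℕ) (h : ℕ → ℝ) (p q u l X : ℝ) : ℕ → Op → ℝ
  | k, Op.OI => if k + 1 < d then (l + 1 / q + 1 / p) * (1 - h k)
      else if k + 1 = d then l else (u + 1 / p) + X * (1 - h k / h d)
  | k, Op.OW => if k < d then l + 1 / q else if k = d then u else u + X

set_option maxHeartbeats 4000000 in
lemma main_potential {n d : ℕ} (hd2 : 2 ≤ d) (hdn : 2 * d ≤ n) {p q : ℝ} (hp0 : 0 < p)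
    (hp1 : p ≤ 1 / 2) (hq0 : 0 < q) (hq1 : q < 1) (h : ℕ → ℝ) (h0 : ℝ) (hh0 : 0 < h0)
    (hh1 : ∀ k, h k ≤ 1) (hanti : Antitone h) (hpos : ∀ k, 0 < h k)
    (hlow : ∀ k, k ≤ n + 1 → h0 ≤ h k)
    (hrec : ∀ k, 1 ≤ k → h k * (p + (1 - p) * (k / n)) ≤ (1 - p) * (k / n) * h (k - 1)) :
    ∃ v : ℕ → Op → ℝ, (∀ k op, 0 ≤ v k op) ∧
      (∀ k op, 1 ≤ k → k ≤ n →
      1 + (k / n * sw p q v op (dn d op k) + (n - k) / n * sw p q v op (up d op k)) ≤ v k op) ∧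
      (∀ k op, k ≤ n → v k op ≤ 64 * (n : ℝ) ^ 2 / (d : ℝ) ^ 2 / h0 ^ 2 * (1 / p + 1 / q)) := by
  have hnr : (0 : ℝ) < n := by exact_mod_cast (by omega : 0 < n)
  have hdr : (2 : ℝ) ≤ d := by exact_mod_cast hd2
  have hdn' : 2 * (d : ℝ) ≤ n := by exact_mod_cast hdn
  have h01 : h0 ≤ 1 := (hlow 0 (by omega)).trans (hh1 0)
  set S := 1 / p + 1 / q with hS
  have hp' : 2 ≤ 1 / p := by rw [le_div_iff₀ hp0]; linarith
  have hq' : 1 ≤ 1 / q := by rw [le_div_iff₀ hq0]; linarith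
  set δ : ℝ := ((d : ℝ) - 1) / n with hδ
  have hδ0 : 0 < δ := by apply div_pos <;> linarith
  have hδ1 : δ ≤ 1 / 2 := by rw [hδ, div_le_iff₀ hnr]; linarith
  set X := S / h0 with hX
  have hXS : S ≤ X := by rw [hX, le_div_iff₀ hh0]; nlinarith
  set ρ : ℝ := (d : ℝ) / n with hρ
  have hρ0 : 0 < ρ := by positivity
  have hρ1 : ρ ≤ 1 / 2 := by rw [hρ, div_le_iff₀ hnr]; linarith
  set u := 16 * X / (ρ * δ * h0) with hu
  have hX0 : 0 < X := by positivity
  have hu1 : ρ * (δ * h0 / 2) * u = 8 * X := by rw [hu]; field_simp; ring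
  have huX : 16 * X ≤ u := by
    rw [hu, le_div_iff₀ (by positivity)]
    have : ρ * δ * h0 ≤ 1 := by
      calc ρ * δ * h0 ≤ 1 * 1 * 1 := by gcongr <;> linarith
        _ = 1 := by ring
    nlinarith
  set l := (1 - δ * h0 / 2) * u + 2 * (S + 1) with hl
  have hδh : δ * h0 ≤ 1 / 2 := by nlinarith
  have hδh0 : 0 < δ * h0 := by positivity
  have hu0 : 0 < u := by linarith
  have hlu : u / 2 ≤ l := by nlinarith
  have hlu' : l ≤ u + 3 * S := by nlinarith
  have hSX : S = h0 * X := by rw [hX]; field_simp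
  -- facts about pot
  set v := pot d h p q u l X with hv
  have vL : ∀ k, k + 1 < d → v k Op.OI = 0 + (l + S) * (1 - h k) := by
    intro k hk; rw [hv, pot, if_pos hk, hS]; ring
  have vl : v (d - 1) Op.OI = l := by
    rw [hv, pot, if_neg (by omega), if_pos (by omega)]
  have vR : ∀ k, d ≤ k → v k Op.OI = (u + 1 / p) + X * (1 - h k / h d) := by
    intro k hk; rw [hv, pot, if_neg (by omega), if_neg (by omega)]
  have vRd : v d Op.OI = u + 1 / p := by
    rw [vR d le_rfl, div_self (hpos d).ne']; ring
  have vW : ∀ k, k < d → v k Op.OW = l + 1 / q := by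
    intro k hk; rw [hv, pot, if_pos hk]
  have vUd : v d Op.OW = u := by rw [hv, pot, if_neg (by omega), if_pos rfl]
  have vU : ∀ k, d < k → v k Op.OW = u + X := by
    intro k hk; rw [hv, pot, if_neg (by omega), if_neg (by omega)]
  have Lle' : ∀ k, k + 1 < d → v k Op.OI ≤ (l + S) * (1 - h0) := by
    intro k hk
    rw [vL k hk, zero_add]
    have := hlow k (by omega)
    have : 0 ≤ l + S := by linarith
    gcongr
  have Lle : ∀ k, k < d → v k Op.OI ≤ l := by
    intro k hk
    by_cases hk1 : k + 1 < d
    · have := Lle' k hk1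
      have : S ≤ h0 * l := by rw [hSX]; gcongr; linarith
      nlinarith
    · have : k = d - 1 := by omega
      rw [this, vl]
  have gle : ∀ k, d ≤ k → h k / h d ≤ 1 := fun k hk => by
    rw [div_le_one (hpos d)]; exact hanti hk
  have gge : ∀ k, k ≤ n + 1 → h0 ≤ h k / h d := fun k hk => by
    rw [le_div_iff₀ (hpos d)]
    have := hlow k hk
    have := hh1 d
    nlinarith [hpos d]
  have Rle : ∀ k, d ≤ k → k ≤ n + 1 → v k Op.OI ≤ u + X - 1 / q := by
    intro k hk hk'
    rw [vR k hk]
    have := gge k hk'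
    have : S ≤ X * (h k / h d) := by rw [hSX, mul_comm]; gcongr
    linarith
  have hn1 : ∀ k : ℕ, ((n : ℝ) - k) / n = 1 - (k : ℝ) / n := by
    intro k; field_simp
  refine ⟨v, ?_, ?_, ?_⟩
  · intro k op
    cases op
    · rcases lt_or_ge k d with hk | hk
      · by_cases hk1 : k + 1 < d
        · rw [vL k hk1, zero_add]
          have := hh1 k
          apply mul_nonneg <;> linarith
        · have : k = d - 1 := by omega
          rw [this, vl]; linarith
      · rw [vR k hk]
        have := mul_nonneg hX0.le (sub_nonneg.2 (gle k hk))
        linarith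
    · rcases lt_trichotomy k d with hk | hk | hk
      · rw [vW k hk]; linarith
      · rw [hk, vUd]; linarith
      · rw [vU k hk]; linarith
  · intro k op hk1 hkn
    have hkr : (k : ℝ) ≤ n := by exact_mod_cast hkn
    have hx0 : 0 ≤ (k : ℝ) / n := by positivity
    have hx1 : (k : ℝ) / n ≤ 1 := by rw [div_le_one hnr]; exact hkr
    rw [hn1]
    cases op
    · rcases lt_trichotomy k d with hk | hk | hk
      · by_cases hk2 : k + 1 < d
        · have e1 : dn d Op.OI k = k - 1 := by simp [dn, hk.ne]
          have e2 : up d Op.OI k = k := by simp [up, hk2.ne]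
          rw [e1, e2]
          simp only [sw]
          rw [vL k hk2, vL (k - 1) (by omega), vW k hk, vW (k - 1) (by omega)]
          exact arith_fall hp0 hx0 (by linarith) le_rfl (by rw [hS]; ring)
            (hrec k hk1)
        · have hkd : k = d - 1 := by omega
          have e1 : dn d Op.OI k = d - 2 := by simp [dn, hk.ne]; omega
          have e2 : up d Op.OI k = d := by
            simp only [up]; rw [if_pos (by omega)]; omega
          have e3 : (k : ℝ) / n = δ := by
            rw [hδ, hkd, Nat.cast_sub (by omega)]; simp
          rw [e1, e2, e3]
          simp only [sw]
          rw [vW (d - 2) (by omega), vRd, vUd, hkd, vl]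
          have a1 := Lle' (d - 2) (by omega)
          have a2 : (1 - p) * v (d - 2) Op.OI + p * (l + 1 / q) ≤ (l + S) * (1 - h0 / 2) := by
            have b1 : (1 - p) * v (d - 2) Op.OI ≤ (1 - p) * ((l + S) * (1 - h0)) := by
              gcongr; linarith
            have b2 : p * (l + 1 / q) ≤ p * (l + S) := by gcongr; linarith
            have b3 : 0 ≤ (l + S) * h0 * (1 / 2 - p) := by
              apply mul_nonneg
              · apply mul_nonneg <;> linarith
              · linarith
            nlinarith
          have a3 : (1 - p) * (u + 1 / p) + p * u ≤ u + S := by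
            have : p * (1 / p) = 1 := by field_simp
            nlinarith
          have a4 : δ * ((1 - p) * v (d - 2) Op.OI + p * (l + 1 / q))
              ≤ δ * ((l + S) * (1 - h0 / 2)) := by gcongr
          have a5 : (1 - δ) * ((1 - p) * (u + 1 / p) + p * u) ≤ (1 - δ) * (u + S) := by
            gcongr; linarith
          -- now: 1 + δ (l+S)(1-h0/2) + (1-δ)(u+S) ≤ l
          have a6 : 1 + (δ * ((l + S) * (1 - h0 / 2)) + (1 - δ) * (u + S)) ≤ l := by
            set c := δ * h0 / 2 with hc
            have c0 : 0 ≤ c := by positivity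
            have e : δ * ((l + S) * (1 - h0 / 2)) = (δ - c) * (l + S) := by rw [hc]; ring
            rw [e]
            have hS0 : 0 ≤ S := by linarith
            -- l (1 - δ + c) ≥ 1 + (1 - c) S + (1-δ) u
            have f1 : l = (1 - c) * u + 2 * (S + 1) := hl
            have f2 : 0 ≤ c * S := by positivity
            have f3 : (1 - δ) * u ≤ (1 - δ + c) * ((1 - c) * u) := by
              have : 0 ≤ c * (δ - c) * u := by
                have : c ≤ δ := by rw [hc]; nlinarith
                have : 0 ≤ δ - c := by linarith
                positivity
              nlinarith
            have f4 : S + 1 ≤ (1 - δ + c) * (2 * (S + 1)) := by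
              have : 1 / 2 ≤ 1 - δ + c := by linarith
              nlinarith
            have f5 : (1 - δ + c) * l = (1 - δ + c) * ((1 - c) * u)
              + (1 - δ + c) * (2 * (S + 1)) := by rw [f1]; ring
            nlinarith
          linarith
      · subst hk
        have e1 : dn k Op.OI k = k := by simp [dn]
        have e2 : up k Op.OI k = k := by simp [up]
        rw [e1, e2]
        simp only [sw]
        rw [vRd, vUd]
        have : p * (1 / p) = 1 := by field_simp
        nlinarith
      · have e1 : dn d Op.OI k = k - 1 := by simp [dn, hk.ne']
        have e2 : up d Op.OI k = k := by simp [up]; omega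
        rw [e1, e2]
        simp only [sw]
        rw [vR k hk.le, vR (k - 1) (by omega), vU k hk]
        refine arith_fall hp0 hx0 hX0.le ?_ (by ring) ?_
        · rcases eq_or_ne (k - 1) d with hkd | hkd
          · rw [hkd, vUd]; linarith
          · rw [vU (k - 1) (by omega)]
        · have := hrec k hk1
          have h3 := div_le_div_of_nonneg_right this (hpos d).le
          calc h k / h d * (p + (1 - p) * ((k : ℝ) / n))
              = h k * (p + (1 - p) * ((k : ℝ) / n)) / h d := by ring
            _ ≤ _ := h3
            _ = _ := by ring
    · rcases lt_trichotomy k d with hk | hk | hk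
      · have e1 : dn d Op.OW k = k := by simp [dn, hk.ne]
        rw [e1]
        have e2 : up d Op.OW k < d := by simp only [up]; split_ifs <;> omega
        simp only [sw]
        rw [vW k hk, vW _ e2]
        exact arith_const hq0 hx0 hx1 (by linarith [Lle k hk]) (by linarith [Lle _ e2])
      · have e1 : dn d Op.OW k = d - 1 := by simp [dn, hk]
        have e2 : up d Op.OW k = d + 1 := by simp [up, hk]
        have e3 : (k : ℝ) / n = ρ := by rw [hk]
        rw [e1, e2, e3, hk]
        simp only [sw]
        rw [vUd, vW (d - 1) (by omega), vl, vU (d + 1) (by omega)]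
        have a1 := Rle (d + 1) (by omega) (by omega)
        have hqS : 1 / q ≤ S := by linarith
        have a2 : (1 - q) * (l + 1 / q) + q * l ≤ u - δ * h0 / 2 * u + 5 * S := by
          have : q * (1 / q) = 1 := by field_simp
          rw [hl]; nlinarith
        have a3 : (1 - q) * (u + X) + q * v (d + 1) Op.OI ≤ u + X := by
          have : q * v (d + 1) Op.OI ≤ q * (u + X) := by gcongr; linarith
          linarith
        have a4 : ρ * ((1 - q) * (l + 1 / q) + q * l)
            ≤ ρ * (u - δ * h0 / 2 * u + 5 * S) := by gcongr
        have a5 : (1 - ρ) * ((1 - q) * (u + X) + q * v (d + 1) Op.OI) ≤ (1 - ρ) * (u + X) := by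
          gcongr; linarith
        nlinarith
      · have e1 : dn d Op.OW k = k := by simp [dn, hk.ne']
        have e2 : up d Op.OW k = k + 1 := by simp [up]; omega
        rw [e1, e2]
        simp only [sw]
        rw [vU k hk, vU (k + 1) (by omega)]
        exact arith_const hq0 hx0 hx1 (Rle k hk.le (by omega)) (Rle (k + 1) (by omega) (by omega))
  · have hfin : 2 * u ≤ 64 * (n : ℝ) ^ 2 / (d : ℝ) ^ 2 / h0 ^ 2 * S := by
      have hd1 : 0 < (d : ℝ) - 1 := by linarith
      have e : 2 * u = 32 * (n : ℝ) ^ 2 / (d * (d - 1)) / h0 ^ 2 * S := by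
        rw [hu, hX, hρ, hδ]; field_simp; ring
      rw [e]
      have : 32 * (n : ℝ) ^ 2 / (d * (d - 1)) ≤ 64 * (n : ℝ) ^ 2 / (d : ℝ) ^ 2 := by
        rw [div_le_div_iff₀ (by positivity) (by positivity)]
        have : (d : ℝ) ^ 2 ≤ 2 * (d * (d - 1)) := by nlinarith
        nlinarith [sq_nonneg (n : ℝ)]
      gcongr
    intro k op hk
    refine le_trans ?_ hfin
    cases op
    · rcases lt_or_ge k d with hk' | hk'
      · linarith [Lle k hk']
      · linarith [Rle k hk' (by omega)]
    · rcases lt_trichotomy k d with hk | hk | hk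
      · rw [vW k hk]; linarith
      · rw [hk, vUd]; linarith
      · rw [vU k hk]; linarith

/-- Rank for the crude argument. -/
def rk (d : ℕ) : ℕ → Op → ℕ
  | k, Op.OI => if k = d then 2 * k + 1 else 2 * k
  | k, Op.OW => if k = d then 2 * k else 2 * k + 1

lemma crude_potential {n d : ℕ} (hn : 0 < n) {p q ε : ℝ} (hp0 : 0 < p)
    (hp1 : p < 1) (hq0 : 0 < q) (hq1 : q < 1) (hε : 0 < ε) (hεp : ε ≤ p / n) (hεq : ε ≤ q / n) :
    ∃ v : ℕ → Op → ℝ, (∀ k op, 0 ≤ v k op) ∧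
      (∀ k op, 1 ≤ k → k ≤ n →
      1 + (k / n * sw p q v op (dn d op k) + (n - k) / n * sw p q v op (up d op k)) ≤ v k op) ∧
      (∀ k op, k ≤ n → v k op ≤ (2 / ε) ^ (2 * n + 1)) := by
  have hnr : (1 : ℝ) ≤ n := by exact_mod_cast hn
  have hnr0 : (0 : ℝ) < n := by linarith
  have hε1 : ε ≤ 1 := hεp.trans (by rw [div_le_one hnr0]; linarith)
  set B := (2 / ε) ^ (2 * n + 1) with hB
  have hB0 : 0 < B := by positivity
  set θ := ε / 2 with hθ
  have hθ0 : 0 < θ := by positivity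
  have hθ1 : θ ≤ 1 := by linarith
  have hBθ : B * θ ^ (2 * n + 1) = 1 := by
    rw [hB, ← mul_pow, hθ]
    have : 2 / ε * (ε / 2) = 1 := by field_simp
    rw [this, one_pow]
  set D : ℕ → Op → ℝ := fun k op => B * θ ^ (rk d k op) with hD
  have D0 : ∀ k op, 0 ≤ D k op := fun k op => by positivity
  have key : ∀ k op op', op ≠ op' → 1 ≤ k → k ≤ n →
      D k op + 1 ≤ ε * D (dn d op k) op' := by
    intro k op op' hop hk hkn
    have r1 : rk d (dn d op k) op' + 1 ≤ rk d k op := by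
      cases op <;> cases op' <;> simp only [ne_eq, not_true_eq_false, reduceCtorEq,
        not_false_eq_true] at hop <;> simp only [dn, rk] <;> split_ifs <;> omega
    have r2 : rk d k op ≤ 2 * n + 1 := by
      cases op <;> simp only [rk] <;> split_ifs <;> omega
    have a1 : 1 ≤ D k op := by
      rw [← hBθ]; simp only [hD]
      gcongr B * ?_
      exact pow_le_pow_of_le_one hθ0.le hθ1 r2
    have a2 : D k op ≤ θ * D (dn d op k) op' := by
      simp only [hD]
      calc B * θ ^ rk d k op ≤ B * θ ^ (rk d (dn d op k) op' + 1) := by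
            gcongr B * ?_
            exact pow_le_pow_of_le_one hθ0.le hθ1 r1
        _ = _ := by ring
    have : ε * D (dn d op k) op' = 2 * (θ * D (dn d op k) op') := by rw [hθ]; ring
    linarith
  refine ⟨fun k op => B - D k op, ?_, ?_, ?_⟩
  · intro k op
    have : θ ^ rk d k op ≤ 1 := pow_le_one₀ hθ0.le hθ1
    simp only [hD]; nlinarith
  · intro k op hk hkn
    have hkr : (k : ℝ) ≤ n := by exact_mod_cast hkn
    have hk1 : (1 : ℝ) ≤ k := by exact_mod_cast hk
    have hx0 : 0 ≤ (k : ℝ) / n := by positivity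
    have hx1 : (k : ℝ) / n ≤ 1 := by rw [div_le_one hnr0]; exact hkr
    have hn1 : ((n : ℝ) - k) / n = 1 - (k : ℝ) / n := by field_simp
    have hxn : 1 / (n : ℝ) ≤ (k : ℝ) / n := by gcongr
    rw [hn1]
    have general : ∀ (r x A1 A2 A3 A4 D' : ℝ), 0 < r → r < 1 → 0 ≤ x → x ≤ 1 → ε ≤ x * r →
        0 ≤ A1 → 0 ≤ A2 → 0 ≤ A3 → 0 ≤ A4 → D' + 1 ≤ ε * A2 →
        1 + (x * ((1 - r) * (B - A1) + r * (B - A2))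
          + (1 - x) * ((1 - r) * (B - A3) + r * (B - A4))) ≤ B - D' := by
      intro r x A1 A2 A3 A4 D' hr0 hr1 hx0 hx1 hxr h1 h2 h3 h4 hD'
      have b1 : 0 ≤ x * (1 - r) * A1 := by
        have : 0 ≤ 1 - r := by linarith
        positivity
      have b3 : 0 ≤ (1 - x) * (1 - r) * A3 := by
        have : 0 ≤ 1 - r := by linarith
        have : 0 ≤ 1 - x := by linarith
        positivity
      have b4 : 0 ≤ (1 - x) * r * A4 := by
        have : 0 ≤ 1 - x := by linarith
        positivity
      have b2 : ε * A2 ≤ x * r * A2 := by gcongr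
      nlinarith
    cases op
    · simp only [sw]
      refine general p _ _ _ _ _ _ hp0 hp1 hx0 hx1 ?_ (D0 _ _) (D0 _ _) (D0 _ _) (D0 _ _)
        (key k Op.OI Op.OW (by simp) hk hkn)
      calc ε ≤ p / n := hεp
        _ = 1 / n * p := by ring
        _ ≤ _ := by gcongr
    · simp only [sw]
      refine general q _ _ _ _ _ _ hq0 hq1 hx0 hx1 ?_ (D0 _ _) (D0 _ _) (D0 _ _) (D0 _ _)
        (key k Op.OW Op.OI (by simp) hk hkn)
      calc ε ≤ q / n := hεq
        _ = 1 / n * q := by ring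
        _ ≤ _ := by gcongr
  · intro k op _
    have := D0 k op
    simp only; linarith

end Potentials

section Final

/-- Probability-like product. -/
noncomputable def hprod (c : ℝ) (k : ℕ) : ℝ :=
  ∏ j ∈ Finset.range k, (((j : ℝ) + 1) / ((j : ℝ) + 1 + c))

lemma hprod_succ (c : ℝ) (k : ℕ) :
    hprod c (k + 1) = hprod c k * (((k : ℝ) + 1) / ((k : ℝ) + 1 + c)) :=
  Finset.prod_range_succ _ _

lemma hprod_pos {c : ℝ} (hc : 0 ≤ c) (k : ℕ) : 0 < hprod c k :=
  Finset.prod_pos fun j _ => by positivity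

lemma hprod_anti {c : ℝ} (hc : 0 ≤ c) : Antitone (hprod c) := by
  refine antitone_nat_of_succ_le fun k => ?_
  rw [hprod_succ]
  refine mul_le_of_le_one_right (hprod_pos hc k).le ?_
  rw [div_le_one (by positivity)]
  linarith

lemma hprod_ge {c : ℝ} (hc : 0 ≤ c) (k : ℕ) :
    Real.exp (-(c * (harmonic k : ℝ))) ≤ hprod c k := by
  induction k with
  | zero => simp [hprod]
  | succ k ih =>
    rw [hprod_succ, harmonic_succ]
    have e : -(c * ((harmonic k + ((k + 1 : ℕ) : ℚ)⁻¹ : ℚ) : ℝ))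
        = -(c * (harmonic k : ℝ)) + -(c / ((k : ℝ) + 1)) := by
      push_cast
      ring
    rw [e, Real.exp_add]
    refine mul_le_mul ih ?_ (Real.exp_pos _).le (hprod_pos hc k).le
    rw [Real.exp_neg, inv_le_comm₀ (Real.exp_pos _) (by positivity)]
    rw [inv_div]
    have := Real.add_one_le_exp (c / ((k : ℝ) + 1))
    refine le_trans (le_of_eq ?_) this
    field_simp
    ring

end Final

/-- Runtime of the MMAHH with OI+OW on `Cliff_d`. -/
theorem mmahh_oi_ow_cliff (a b : ℝ) (ha : 0 < a) (hab : a ≤ b) :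
    ∃ C : ℝ, 0 < C ∧
      ∀ (n d : ℕ), 4 ≤ n → 2 ≤ d → 2 * d ≤ n →
        ∀ (p q : ℝ), 0 < p → p < 1 → 0 < q → q < 1 →
            a / ((n : ℝ) * Real.log n) ≤ p → p ≤ b / ((n : ℝ) * Real.log n) →
            a / ((n : ℝ) * Real.log n) ≤ q → q ≤ b / ((n : ℝ) * Real.log n) →
            ∀ (Ω : Type) [MeasurableSpace Ω] (μ : Measure Ω) (X : ℕ → Ω → Point n × Op),
              IsProbabilityMeasure μ →
              IsMMAHH μ X (Cliff n d) p q →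
              (∀ x0 : Point n, μ {ω | X 0 ω = (x0, Op.OI)} = 1 / 2 ^ n) →
              ∫⁻ ω, (hitTime X ω : ℝ≥0∞) ∂μ ≤
                ENNReal.ofReal (C * ((n : ℝ) ^ 3 / (d : ℝ) ^ 2) * Real.log n) := by
  have hb : 0 < b := ha.trans_le hab
  refine ⟨128 / a / Real.exp (-(6 * b)) ^ 2 + (2 / (a / (4 * b ^ 2))) ^ (2 * ⌈2 * b⌉₊ + 1),
    by positivity, ?_⟩
  intro n d hn hd2 hdn p q hp0 hp1 hq0 hq1 hpa hpb hqa hqb Ω _ μ X hμ hX _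
  have hnr : (4 : ℝ) ≤ n := by exact_mod_cast hn
  have hdr : (2 : ℝ) ≤ d := by exact_mod_cast hd2
  have hdnr : 2 * (d : ℝ) ≤ n := by exact_mod_cast hdn
  have hlog : 1 ≤ Real.log n := by
    rw [Real.le_log_iff_exp_le (by linarith)]
    have := Real.exp_one_lt_d9
    linarith
  have hM : 0 < (n : ℝ) * Real.log n := by positivity
  have hn0 : (0 : ℝ) < n := by linarith
  by_cases hp2 : p ≤ 1 / 2
  · set c : ℝ := 2 * (p * n) with hc
    have hc0 : 0 ≤ c := by positivity
    have hpM : p * ((n : ℝ) * Real.log n) ≤ b := (le_div_iff₀ hM).1 hpb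
    have hlow : ∀ k, k ≤ n + 1 → Real.exp (-(6 * b)) ≤ hprod c k := by
      intro k hk
      refine le_trans ?_ (hprod_anti hc0 hk)
      refine le_trans ?_ (hprod_ge hc0 (n + 1))
      apply Real.exp_le_exp.2
      have h1 : (harmonic (n + 1) : ℝ) ≤ 1 + Real.log ((n + 1 : ℕ) : ℝ) :=
        harmonic_le_one_add_log (n + 1)
      have h2 : Real.log ((n + 1 : ℕ) : ℝ) ≤ 1 + Real.log n := by
        have e : 1 + Real.log n = Real.log (Real.exp 1 * n) := by
          rw [Real.log_mul (Real.exp_pos 1).ne' hn0.ne', Real.log_exp]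
        rw [e]
        apply Real.log_le_log
        · positivity
        · push_cast
          have := Real.add_one_le_exp 1
          nlinarith
      have h3 : (harmonic (n + 1) : ℝ) ≤ 3 * Real.log n := by linarith
      have h4 : c * (harmonic (n + 1) : ℝ) ≤ c * (3 * Real.log n) := by gcongr
      have h5 : c * (3 * Real.log n) = 6 * (p * ((n : ℝ) * Real.log n)) := by rw [hc]; ring
      linarith
    have hrec : ∀ k : ℕ, 1 ≤ k → hprod c k * (p + (1 - p) * ((k : ℝ) / n))
        ≤ (1 - p) * ((k : ℝ) / n) * hprod c (k - 1) := by
      intro k hk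
      obtain ⟨m, rfl⟩ : ∃ m, k = m + 1 := ⟨k - 1, by omega⟩
      rw [hprod_succ, Nat.add_sub_cancel]
      have hm := hprod_pos hc0 m
      push_cast
      have key : ((m : ℝ) + 1) / ((m : ℝ) + 1 + c) * (p + (1 - p) * (((m : ℝ) + 1) / n))
          ≤ (1 - p) * (((m : ℝ) + 1) / n) := by
        have e : p + (1 - p) * (((m : ℝ) + 1) / n) = (p * n + (1 - p) * ((m : ℝ) + 1)) / n := by
          field_simp
        rw [e, div_mul_div_comm, mul_div_assoc', div_le_div_iff₀ (by positivity) hn0]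
        have e2 : p * n + (1 - p) * ((m : ℝ) + 1) ≤ (1 - p) * ((m : ℝ) + 1 + c) := by
          rw [hc]
          have : 0 ≤ p * n := by positivity
          nlinarith
        have e3 := mul_le_mul_of_nonneg_left e2 (by positivity : 0 ≤ ((m : ℝ) + 1) * n)
        nlinarith
      have := mul_le_mul_of_nonneg_left key hm.le
      nlinarith
    obtain ⟨v, hv0, hv1, hv2⟩ := main_potential hd2 hdn hp0 hp2 hq0 hq1 (hprod c)
      (Real.exp (-(6 * b))) (Real.exp_pos _)
      (fun k => by
        have := hprod_anti hc0 (Nat.zero_le k)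
        simpa [hprod] using this)
      (hprod_anti hc0) (hprod_pos hc0) hlow hrec
    refine (runtime_le hd2 (by omega) hp0 hp1 hq0 hq1 v hv0 hv1 _ hv2 μ X hX).trans ?_
    apply ENNReal.ofReal_le_ofReal
    have inv : ∀ r : ℝ, 0 < r → a / ((n : ℝ) * Real.log n) ≤ r →
        1 / r ≤ (n : ℝ) * Real.log n / a := by
      intro r hr h
      rw [div_le_iff₀ hM] at h
      rw [div_le_div_iff₀ hr ha]
      linarith
    have i1 := inv p hp0 hpa
    have i2 := inv q hq0 hqa
    calc 64 * (n : ℝ) ^ 2 / (d : ℝ) ^ 2 / Real.exp (-(6 * b)) ^ 2 * (1 / p + 1 / q)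
        ≤ 64 * (n : ℝ) ^ 2 / (d : ℝ) ^ 2 / Real.exp (-(6 * b)) ^ 2
          * ((n : ℝ) * Real.log n / a + (n : ℝ) * Real.log n / a) := by gcongr
      _ = 128 / a / Real.exp (-(6 * b)) ^ 2 * ((n : ℝ) ^ 3 / (d : ℝ) ^ 2) * Real.log n := by
          field_simp; ring
      _ ≤ _ := by
          gcongr
          have : 0 < (2 / (a / (4 * b ^ 2))) ^ (2 * ⌈2 * b⌉₊ + 1) := by positivity
          linarith
  · push Not at hp2
    have hpM : p * ((n : ℝ) * Real.log n) ≤ b := (le_div_iff₀ hM).1 hpb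
    have hM2 : (n : ℝ) * Real.log n ≤ 2 * b := by nlinarith
    have hn2b : (n : ℝ) ≤ 2 * b := by nlinarith
    have low : ∀ r : ℝ, 0 < r → a / ((n : ℝ) * Real.log n) ≤ r → a / (4 * b ^ 2) ≤ r / n := by
      intro r hr h
      rw [div_le_iff₀ hM] at h
      rw [div_le_div_iff₀ (by positivity) hn0]
      calc a * n ≤ (r * (n * Real.log n)) * n := by gcongr
        _ ≤ (r * (2 * b)) * (2 * b) := by gcongr
        _ = _ := by ring
    have l1 := low p hp0 hpa
    have l2 := low q hq0 hqa
    have hε0 : 0 < a / (4 * b ^ 2) := by positivity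
    obtain ⟨v, hv0, hv1, hv2⟩ := crude_potential (d := d) (by omega : 0 < n) hp0 hp1 hq0 hq1
      hε0 l1 l2
    refine (runtime_le hd2 (by omega) hp0 hp1 hq0 hq1 v hv0 hv1 _ hv2 μ X hX).trans ?_
    apply ENNReal.ofReal_le_ofReal
    have hε1 : a / (4 * b ^ 2) ≤ 1 := l1.trans (by rw [div_le_one hn0]; linarith)
    have hbase : 1 ≤ 2 / (a / (4 * b ^ 2)) := by
      rw [le_div_iff₀ hε0]; linarith
    have hnle : n ≤ ⌈2 * b⌉₊ := by
      exact_mod_cast hn2b.trans (Nat.le_ceil (2 * b))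
    have hone : 1 ≤ (n : ℝ) ^ 3 / (d : ℝ) ^ 2 := by
      rw [one_le_div (by positivity)]
      calc (d : ℝ) ^ 2 ≤ (n : ℝ) ^ 2 := by gcongr; linarith
        _ ≤ (n : ℝ) ^ 3 := pow_le_pow_right₀ (by linarith) (by norm_num)
    set Z := (2 / (a / (4 * b ^ 2))) ^ (2 * ⌈2 * b⌉₊ + 1) with hZ
    have hZ0 : 0 < Z := by positivity
    calc (2 / (a / (4 * b ^ 2))) ^ (2 * n + 1) ≤ Z :=
          pow_le_pow_right₀ hbase (by omega)
      _ = Z * 1 * 1 := by ring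
      _ ≤ Z * ((n : ℝ) ^ 3 / (d : ℝ) ^ 2) * Real.log n := by gcongr
      _ ≤ _ := by
          gcongr
          have : 0 < 128 / a / Real.exp (-(6 * b)) ^ 2 := by positivity
          linarith

end MMAHHStmt
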